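/- Assume n_1 = n_3 and n_2 < n_4 (so n = n_4). Fix a Smith datum (U^{(3)}, V^{(3)}, d^{(3)}_1 | … | d^{(3)}_{s_3}) for (E_{11}; E_{21}), a Smith datum (U^{(2)}, V^{(2)}, d^{(2)}_1 | … | d^{(2)}_{s_2}) for (E_{11}; E_{12}; E_{21}), and a Smith datum (U^{(4)}, V^{(4)}, d^{(4)}_1 | … | d^{(4)}_{s_4}) for (E_{11}; E_{12}; E_{21}; E_{22}). Define H_3 = #{(u_1,…,u_{r_1}, v_1,…,v_{r_3}) ∈ (F_q^*)^{r_1+r_3} : Σ_{i=1}^{r_1} a_{1,i} u_i = b_1, Σ_{j=1}^{r_3} a_{2,j} v_j = b_2, and (u,v) satisfies the index condition for ((E_{11}; E_{21}), U^{(3)}, d^{(3)})}; H_2 = #{(u_1,…,u_{r_2}, v_1,…,v_{r_3}) ∈ (F_q^*)^{r_2+r_3} : Σ_{i=1}^{r_2} a_{1,i} u_i = b_1, Σ_{j=1}^{r_3} a_{2,j} v_j = b_2, and (u,v) satisfies the index condition for ((E_{11}; E_{12}; E_{21}), U^{(2)}, d^{(2)})}; H_4 = #{(u_1,…,u_{r_2},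 v_1,…,v_{r_4}) ∈ (F_q^*)^{r_2+r_4} : Σ_{i=1}^{r_2} a_{1,i} u_i = b_1, Σ_{j=1}^{r_4} a_{2,j} v_j = b_2, and (u,v) satisfies the index condition for ((E_{11}; E_{12}; E_{21}; E_{22}), U^{(4)}, d^{(4)})}; and for l = 2,3,4 set L_l = H_l · (q−1)^{n_l − s_l} · ∏_{j=1}^{s_l} gcd(q−1, d^{(l)}_j). Then N = N_0 + N_2 + N_3 + N_4, where N_0 = q^{n_4−n_1}(q^{n_1} − (q−1)^{n_1}) if b_1 = b_2 = 0 and N_0 = 0 otherwise; N_2 = q^{n_4−n_2}(q^{n_2−n_3} − (q−1)^{n_2−n_3}) L_3; N_3 = (q^{n_4−n_2} − (q−1)^{n_4−n_2}) L_2; and N_4 = L_4. -/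

import Mathlib

open Finset

/-- Stack the first `p1` rows of `E1` on top of the first `p2` rows of `E2`,
viewed as an integer matrix with `n` columns. -/
def stackM (E1 E2 : ℕ → ℕ → ℕ) (p1 p2 n : ℕ) :
    Matrix (Fin (p1 + p2)) (Fin n) ℤ :=
  Matrix.of fun i j =>
    if (i : ℕ) < p1 then (E1 (i : ℕ) (j : ℕ) : ℤ) else (E2 ((i : ℕ) - p1) (j : ℕ) : ℤ)

/-- `(U, V, d 0 ∣ d 1 ∣ ⋯ ∣ d (s-1))` is a Smith datum for the matrix `M`:
`U` and `V` are unimodular and `U * M * V` is diagonal with the positive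
invariant factors `d 0 ∣ ⋯ ∣ d (s-1)` on the diagonal and zeros elsewhere. -/
def IsSmithDatum {ρ n : ℕ} (M : Matrix (Fin ρ) (Fin n) ℤ)
    (U : Matrix (Fin ρ) (Fin ρ) ℤ) (V : Matrix (Fin n) (Fin n) ℤ)
    (s : ℕ) (d : ℕ → ℕ) : Prop :=
  IsUnit U.det ∧ IsUnit V.det ∧ s ≤ ρ ∧ s ≤ n ∧
    (∀ j, j < s → 0 < d j) ∧ (∀ j, j + 1 < s → d j ∣ d (j + 1)) ∧
    ∀ i k, (U * M * V) i k =
      if (i : ℕ) = (k : ℕ) ∧ (i : ℕ) < s then (d (i : ℕ) : ℤ) else 0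

/-- The index condition: writing `h' = U ⬝ w` (where `w` is the vector of
indices of the `uᵢ`), one has `gcd (m, d j) ∣ h'_j` for `j < s` and
`m ∣ h'_j` for `s ≤ j`. Here `m` plays the role of `q - 1`. -/
def IndexCond {ρ : ℕ} (m : ℕ) (U : Matrix (Fin ρ) (Fin ρ) ℤ)
    (s : ℕ) (d : ℕ → ℕ) (w : Fin ρ → ℤ) : Prop :=
  ∀ j : Fin ρ,
    (if (j : ℕ) < s then ((Nat.gcd m (d (j : ℕ))) : ℤ) else (m : ℤ)) ∣ (U.mulVec w) j

/-- The number of solutions of the linear congruence `d * t = c` in `ZMod m`. -/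
theorem card_zmod_mul_eq_of_dvd (m : ℕ) [NeZero m] (d : ℕ) (c : ℤ)
    (hc : ((Nat.gcd m d : ℕ) : ℤ) ∣ c) :
    Nat.card {t : ZMod m // (d : ZMod m) * t = (c : ZMod m)} = Nat.gcd m d := by
  obtain ⟨e, rfl⟩ := hc
  set g := Nat.gcd m d with hg
  have hbez : (d : ZMod m) * (Nat.gcdB m d : ZMod m) = (g : ZMod m) := by
    have h := congrArg (Int.cast : ℤ → ZMod m) (Nat.gcd_eq_gcd_ab m d)
    simp only [Int.cast_natCast, Int.cast_add, Int.cast_mul, ZMod.natCast_self, zero_mul,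
      zero_add] at h
    exact h.symm
  set t₀ : ZMod m := (Nat.gcdB m d : ZMod m) * (e : ZMod m) with ht₀
  have ht : (d : ZMod m) * t₀ = (((g : ℤ) * e : ℤ) : ZMod m) := by
    rw [ht₀, ← mul_assoc, hbez]
    push_cast
    rfl
  let φ : ZMod m →+ ZMod m := AddMonoidHom.mulLeft (d : ZMod m)
  have hker : Nat.card {t : ZMod m // (d : ZMod m) * t = (((g : ℤ) * e : ℤ) : ZMod m)} =
      Nat.card φ.ker := by
    refine Nat.card_congr (Equiv.subtypeEquiv (Equiv.subRight t₀) fun t => ?_)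
    simp only [Equiv.subRight_apply, AddMonoidHom.mem_ker, φ, AddMonoidHom.coe_mulLeft,
      mul_sub, sub_eq_zero, ht]
  have hrange : Nat.card φ.range = m / g := by
    have h : φ.range = AddSubgroup.zmultiples (d : ZMod m) := by
      ext y
      simp only [AddMonoidHom.mem_range, AddSubgroup.mem_zmultiples_iff, φ,
        AddMonoidHom.coe_mulLeft, zsmul_eq_mul]
      constructor
      · rintro ⟨x, rfl⟩
        exact ⟨(x.val : ℤ), by simp [mul_comm]⟩
      · rintro ⟨k, rfl⟩
        exact ⟨(k : ZMod m), mul_comm _ _⟩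
    rw [h, Nat.card_zmultiples, ZMod.addOrderOf_coe _ (NeZero.ne m)]
  have hprod : Nat.card φ.ker * Nat.card φ.range = m := by
    rw [← AddSubgroup.index_ker, AddSubgroup.card_mul_index, Nat.card_zmod]
  have hgm : g ∣ m := Nat.gcd_dvd_left m d
  have hpos : 0 < m / g :=
    Nat.div_pos (Nat.le_of_dvd (NeZero.pos m) hgm) (Nat.gcd_pos_of_pos_left _ (NeZero.pos m))
  rw [hker]
  rw [hrange] at hprod
  refine Nat.eq_of_mul_eq_mul_right hpos ?_
  rw [hprod, Nat.mul_div_cancel' hgm]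

theorem gcd_dvd_of_zmod_mul_eq (m d : ℕ) (c : ℤ) (t : ZMod m)
    (ht : (d : ZMod m) * t = (c : ZMod m)) : ((Nat.gcd m d : ℕ) : ℤ) ∣ c := by
  obtain ⟨z, rfl⟩ := ZMod.intCast_surjective t
  have h : (m : ℤ) ∣ c - d * z := by
    rw [← ZMod.intCast_eq_intCast_iff_dvd_sub]
    push_cast
    exact ht
  have h1 : ((Nat.gcd m d : ℕ) : ℤ) ∣ (m : ℤ) := Int.natCast_dvd_natCast.2 (Nat.gcd_dvd_left m d)
  have h2 : ((Nat.gcd m d : ℕ) : ℤ) ∣ (d : ℤ) := Int.natCast_dvd_natCast.2 (Nat.gcd_dvd_right m d)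
  simpa using dvd_add (h1.trans h) (h2.mul_right z)

/-- A matrix whose columns of index at least `k` vanish has at most `k` invariant factors. -/
theorem IsSmithDatum.le_of_cols_eq_zero {ρ n : ℕ} {M : Matrix (Fin ρ) (Fin n) ℤ}
    {U : Matrix (Fin ρ) (Fin ρ) ℤ} {V : Matrix (Fin n) (Fin n) ℤ} {s : ℕ} {d : ℕ → ℕ}
    (h : IsSmithDatum M U V s d) {k : ℕ} (hk : k ≤ n)
    (hM : ∀ i (j : Fin n), k ≤ (j : ℕ) → M i j = 0) : s ≤ k := by
  obtain ⟨-, -, hsρ, hsn, hpos, -, hD⟩ := h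
  obtain ⟨l, rfl⟩ := Nat.exists_eq_add_of_le hk
  let X : Matrix (Fin s) (Fin k) ℚ :=
    Matrix.of fun i j => (((U * M) (Fin.castLE hsρ i) (Fin.castAdd l j) : ℤ) : ℚ)
  let Y : Matrix (Fin k) (Fin s) ℚ :=
    Matrix.of fun j i => ((V (Fin.castAdd l j) (Fin.castLE hsn i) : ℤ) : ℚ)
  have hUM : ∀ i (j : Fin l), (U * M) i (Fin.natAdd k j) = 0 := fun i j => by
    rw [Matrix.mul_apply]
    exact Finset.sum_eq_zero fun r _ => by rw [hM _ _ (by simp), mul_zero]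
  have hXY : X * Y = Matrix.diagonal fun i : Fin s => (d (i : ℕ) : ℚ) := by
    ext i j
    have h := hD (Fin.castLE hsρ i) (Fin.castLE hsn j)
    rw [Matrix.mul_apply, Fin.sum_univ_add] at h
    simp only [hUM, zero_mul, Finset.sum_const_zero, add_zero, Fin.val_castLE, i.2, and_true] at h
    rw [Matrix.mul_apply, Matrix.diagonal_apply]
    simp only [X, Y, Matrix.of_apply]
    have h' := congrArg (Int.cast : ℤ → ℚ) h
    push_cast at h'
    rw [h']
    simp only [Fin.ext_iff]
  have hrank : (X * Y).rank = s := by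
    rw [hXY, Matrix.rank_of_isUnit, Fintype.card_fin]
    rw [Matrix.isUnit_diagonal, Pi.isUnit_iff]
    exact fun i => isUnit_iff_ne_zero.2 (Nat.cast_ne_zero.2 (hpos i i.2).ne')
  rw [← hrank]
  exact (Matrix.rank_mul_le_left X Y).trans (by simpa using Matrix.rank_le_width X)

theorem bijective_mulVec_map_of_isUnit_det {n : ℕ} {U : Matrix (Fin n) (Fin n) ℤ}
    (hU : IsUnit U.det) (R : Type*) [CommRing R] :
    Function.Bijective (U.map (Int.castRingHom R)).mulVec := by
  have h : IsUnit (U.map (Int.castRingHom R)) :=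
    ((Matrix.isUnit_iff_isUnit_det U).2 hU).map (Int.castRingHom R).mapMatrix
  exact ⟨Matrix.mulVec_injective_of_isUnit h, Matrix.mulVec_surjective_iff_isUnit.2 h⟩

/-- The system `M y = c` over `ZMod m`, rewritten in the coordinates of a Smith datum. -/
theorem IsSmithDatum.mulVec_mulVec_eq_iff {ρ n : ℕ} {M : Matrix (Fin ρ) (Fin n) ℤ}
    {U : Matrix (Fin ρ) (Fin ρ) ℤ} {V : Matrix (Fin n) (Fin n) ℤ} {s : ℕ} {d : ℕ → ℕ}
    (h : IsSmithDatum M U V s d) (m : ℕ) (c : Fin ρ → ℤ) (z : Fin n → ZMod m) :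
    (M.map (Int.castRingHom (ZMod m))).mulVec ((V.map (Int.castRingHom (ZMod m))).mulVec z) =
        (fun i => (c i : ZMod m)) ↔
      ∀ i : Fin ρ, (if hi : (i : ℕ) < s then
        (d i : ZMod m) * z ⟨i, hi.trans_le h.2.2.2.1⟩ else 0) = ((U.mulVec c i : ℤ) : ZMod m) := by
  obtain ⟨hU, hV, hsρ, hsn, hpos, hdiv, hD⟩ := h
  rw [← (bijective_mulVec_map_of_isUnit_det hU (ZMod m)).injective.eq_iff,
    Matrix.mulVec_mulVec, Matrix.mulVec_mulVec, ← Matrix.map_mul, ← Matrix.map_mul,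
    funext_iff]
  refine forall_congr' fun i => ?_
  have hr : (U.map (Int.castRingHom (ZMod m))).mulVec (fun i => (c i : ZMod m)) i =
      ((U.mulVec c i : ℤ) : ZMod m) := by
    simp [Matrix.mulVec, dotProduct]
  have hl : ((U * M * V).map (Int.castRingHom (ZMod m))).mulVec z i =
      if hi : (i : ℕ) < s then (d i : ZMod m) * z ⟨i, hi.trans_le hsn⟩ else 0 := by
    simp only [Matrix.mulVec, dotProduct, Matrix.map_apply, hD]
    split_ifs with hi
    · rw [Finset.sum_eq_single ⟨(i : ℕ), hi.trans_le hsn⟩]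
      · simp [hi]
      · intro k _ hk
        have : (i : ℕ) ≠ k := fun e => hk (Fin.ext e.symm)
        simp [this]
      · simp
    · simp [hi]
  rw [hr, hl]

theorem IsSmithDatum.indexCond_of_mulVec_eq {ρ n : ℕ} {M : Matrix (Fin ρ) (Fin n) ℤ}
    {U : Matrix (Fin ρ) (Fin ρ) ℤ} {V : Matrix (Fin n) (Fin n) ℤ} {s : ℕ} {d : ℕ → ℕ}
    (h : IsSmithDatum M U V s d) (m : ℕ) (c : Fin ρ → ℤ) (y : Fin n → ZMod m)
    (hy : (M.map (Int.castRingHom (ZMod m))).mulVec y = fun i => (c i : ZMod m)) :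
    IndexCond m U s d c := by
  obtain ⟨z, rfl⟩ := (bijective_mulVec_map_of_isUnit_det h.2.1 (ZMod m)).surjective y
  rw [h.mulVec_mulVec_eq_iff] at hy
  intro i
  have hi := hy i
  split_ifs at hi ⊢ with his
  · exact gcd_dvd_of_zmod_mul_eq m (d i) _ _ hi
  · exact (ZMod.intCast_zmod_eq_zero_iff_dvd _ _).1 hi.symm

/-- The number of solutions of a solvable linear system over `ZMod m`. -/
theorem IsSmithDatum.card_mulVec_eq {ρ n : ℕ} {M : Matrix (Fin ρ) (Fin n) ℤ}
    {U : Matrix (Fin ρ) (Fin ρ) ℤ} {V : Matrix (Fin n) (Fin n) ℤ} {s : ℕ} {d : ℕ → ℕ}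
    (h : IsSmithDatum M U V s d) (m : ℕ) [NeZero m] (c : Fin ρ → ℤ)
    (hc : IndexCond m U s d c) :
    Nat.card {y : Fin n → ZMod m //
        (M.map (Int.castRingHom (ZMod m))).mulVec y = fun i => (c i : ZMod m)} =
      m ^ (n - s) * ∏ j ∈ Finset.range s, Nat.gcd m (d j) := by
  have hsρ : s ≤ ρ := h.2.2.1
  have hsn : s ≤ n := h.2.2.2.1
  let P : (k : Fin n) → ZMod m → Prop := fun k t => ∀ hk : (k : ℕ) < s,
    (d k : ZMod m) * t = ((U.mulVec c ⟨k, hk.trans_le hsρ⟩ : ℤ) : ZMod m)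
  have hcard : ∀ k, Nat.card {t : ZMod m // P k t} =
      if (k : ℕ) < s then Nat.gcd m (d k) else m := by
    intro k
    split_ifs with hk
    · have hdvd := hc ⟨k, hk.trans_le hsρ⟩
      simp only [hk, if_true] at hdvd
      rw [← card_zmod_mul_eq_of_dvd m (d k) _ hdvd]
      exact Nat.card_congr (Equiv.subtypeEquivRight fun t => by simp [P, hk])
    · rw [Nat.card_congr (Equiv.subtypeUnivEquiv fun t => by simp [P, hk]), Nat.card_zmod]
  have hequiv : Nat.card {y : Fin n → ZMod m //
        (M.map (Int.castRingHom (ZMod m))).mulVec y = fun i => (c i : ZMod m)} =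
      Nat.card {z : Fin n → ZMod m // ∀ k, P k (z k)} := by
    refine (Nat.card_congr (Equiv.subtypeEquiv
      (Equiv.ofBijective _ (bijective_mulVec_map_of_isUnit_det h.2.1 (ZMod m)))
      fun z => ?_)).symm
    rw [Equiv.ofBijective_apply, h.mulVec_mulVec_eq_iff]
    constructor
    · intro hz i
      split_ifs with hi
      · exact hz ⟨i, hi.trans_le hsn⟩ hi
      · have hdvd := hc i
        simp only [hi, if_false] at hdvd
        exact ((ZMod.intCast_zmod_eq_zero_iff_dvd _ _).2 hdvd).symm
    · intro hz k hk
      simpa [hk] using hz ⟨k, hk.trans_le hsρ⟩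
  rw [hequiv, Nat.card_congr Equiv.subtypePiEquivPi, Nat.card_pi]
  simp only [hcard]
  rw [Fin.prod_univ_eq_prod_range (fun k => if k < s then Nat.gcd m (d k) else m) n,
    ← Finset.prod_range_mul_prod_Ico _ hsn, mul_comm]
  congr 1
  · rw [Finset.prod_congr rfl fun k hk => if_neg (Finset.mem_Ico.1 hk).1.not_gt]
    simp
  · exact Finset.prod_congr rfl fun k hk => if_pos (Finset.mem_range.1 hk)

/-- The discrete logarithm of a cyclic group of order `m`, with values in `ZMod m`. -/
theorem bijective_discreteLog {G : Type*} [CommGroup G] [Finite G] {α : G}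
    (hα : ∀ β : G, β ∈ Subgroup.zpowers α) {ind : G → ℕ} (hind : ∀ β, α ^ ind β = β) :
    Function.Bijective fun β : G => (ind β : ZMod (Nat.card G)) := by
  have : NeZero (Nat.card G) := ⟨Nat.card_pos.ne'⟩
  rw [Nat.bijective_iff_injective_and_card, Nat.card_zmod]
  refine ⟨fun β γ h => ?_, rfl⟩
  rw [← hind β, ← hind γ, pow_eq_pow_iff_modEq, orderOf_eq_card_of_forall_mem_zpowers hα]
  exact (ZMod.natCast_eq_natCast_iff _ _ _).1 h

theorem discreteLog_prod_pow {G : Type*} [CommGroup G] [Finite G] {α : G}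
    (hα : ∀ β : G, β ∈ Subgroup.zpowers α) {ind : G → ℕ} (hind : ∀ β, α ^ ind β = β)
    {ι : Type*} [Fintype ι] (x : ι → G) (e : ι → ℕ) :
    (ind (∏ j, x j ^ e j) : ZMod (Nat.card G)) = ∑ j, (e j : ZMod (Nat.card G)) * ind (x j) := by
  have h : α ^ ind (∏ j, x j ^ e j) = α ^ ∑ j, e j * ind (x j) := by
    rw [hind, ← Finset.prod_pow_eq_pow_sum]
    exact Finset.prod_congr rfl fun j _ => by rw [mul_comm, pow_mul, hind]
  rw [pow_eq_pow_iff_modEq, orderOf_eq_card_of_forall_mem_zpowers hα,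
    ← ZMod.natCast_eq_natCast_iff] at h
  rw [h]
  push_cast
  rfl

/-- Counting tuples in a cyclic group through the values of a family of monomials. -/
theorem IsSmithDatum.card_monomial_values {G : Type*} [CommGroup G] [Finite G] {α : G}
    (hα : ∀ β : G, β ∈ Subgroup.zpowers α) {ind : G → ℕ} (hind : ∀ β, α ^ ind β = β)
    {ρ n : ℕ} {E : Fin ρ → Fin n → ℕ}
    {U : Matrix (Fin ρ) (Fin ρ) ℤ} {V : Matrix (Fin n) (Fin n) ℤ} {s : ℕ} {d : ℕ → ℕ}
    (h : IsSmithDatum (Matrix.of fun i j => (E i j : ℤ)) U V s d) (P : (Fin ρ → G) → Prop) :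
    Nat.card {x : Fin n → G // P fun i => ∏ j, x j ^ E i j} =
      Nat.card {w : Fin ρ → G // P w ∧ IndexCond (Nat.card G) U s d fun i => (ind (w i) : ℤ)} *
        (Nat.card G ^ (n - s) * ∏ j ∈ Finset.range s, Nat.gcd (Nat.card G) (d j)) := by
  classical
  have : NeZero (Nat.card G) := ⟨Nat.card_pos.ne'⟩
  have := Fintype.ofFinite G
  set m := Nat.card G
  let log : G ≃ ZMod m := Equiv.ofBijective _ (bijective_discreteLog hα hind)
  have hiff : ∀ (x : Fin n → G) (w : Fin ρ → G), (fun i => ∏ j, x j ^ E i j) = w ↔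
      ((Matrix.of fun i j => (E i j : ℤ)).map (Int.castRingHom (ZMod m))).mulVec
        (fun j => log (x j)) = fun i => (((ind (w i) : ℕ) : ℤ) : ZMod m) := by
    intro x w
    rw [funext_iff, funext_iff]
    refine forall_congr' fun i => ?_
    rw [← log.injective.eq_iff]
    change ((ind (∏ j, x j ^ E i j) : ℕ) : ZMod m) = ((ind (w i) : ℕ) : ZMod m) ↔ _
    rw [discreteLog_prod_pow hα hind]
    simp [Matrix.mulVec, dotProduct, log]
  rw [Nat.card_eq_fintype_card, Nat.card_eq_fintype_card, Fintype.card_subtype,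
    Fintype.card_subtype, Finset.card_eq_sum_card_fiberwise
      (f := fun (x : Fin n → G) (i : Fin ρ) => ∏ j, x j ^ E i j)
      (t := Finset.univ.filter fun w : Fin ρ → G =>
        P w ∧ IndexCond m U s d fun i => (ind (w i) : ℤ))]
  · refine Finset.sum_const_nat fun w hw => ?_
    obtain ⟨hPw, hIw⟩ := (Finset.mem_filter.1 hw).2
    rw [← h.card_mulVec_eq m _ hIw, Finset.filter_filter, ← Fintype.card_subtype,
      ← Nat.card_eq_fintype_card]
    refine Nat.card_congr (Equiv.subtypeEquiv (Equiv.piCongrRight fun _ => log) fun x => ?_)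
    rw [show (Equiv.piCongrRight fun _ => log) x = fun j => log (x j) from rfl, ← hiff]
    exact ⟨fun hx => hx.2, fun hx => ⟨by rw [hx]; exact hPw, hx⟩⟩
  · intro x hx
    simp only [Finset.coe_filter, Finset.mem_univ, true_and, Set.mem_ofPred_eq] at hx ⊢
    exact ⟨hx, h.indexCond_of_mulVec_eq m _ _ ((hiff x _).1 rfl)⟩

/-- The number of points with nonzero coordinates on a pair of hypersurfaces. -/
theorem IsSmithDatum.card_torus_points {F : Type*} [Field F] [Finite F] {α : Fˣ}
    (hα : ∀ β : Fˣ, β ∈ Subgroup.zpowers α) {ind : Fˣ → ℕ} (hind : ∀ β, α ^ ind β = β)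
    {r r' n : ℕ} {E₁ E₂ : ℕ → ℕ → ℕ}
    {U : Matrix (Fin (r + r')) (Fin (r + r')) ℤ} {V : Matrix (Fin n) (Fin n) ℤ}
    {s : ℕ} {d : ℕ → ℕ} (h : IsSmithDatum (stackM E₁ E₂ r r' n) U V s d)
    (a₁ a₂ : ℕ → Fˣ) (b₁ b₂ : F) :
    Nat.card {x : Fin n → F // (∀ j, x j ≠ 0) ∧
        (∑ i ∈ Finset.range r, (a₁ i : F) * ∏ j : Fin n, x j ^ E₁ i (j : ℕ)) = b₁ ∧
        (∑ i ∈ Finset.range r', (a₂ i : F) * ∏ j : Fin n, x j ^ E₂ i (j : ℕ)) = b₂} =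
      Nat.card {w : Fin (r + r') → Fˣ //
        (∑ i : Fin (r + r'), if (i : ℕ) < r then (a₁ (i : ℕ) : F) * ((w i : F)) else 0) = b₁ ∧
        (∑ i : Fin (r + r'),
          if r ≤ (i : ℕ) then (a₂ ((i : ℕ) - r) : F) * ((w i : F)) else 0) = b₂ ∧
        IndexCond (Nat.card Fˣ) U s d fun i => (ind (w i) : ℤ)} *
      (Nat.card Fˣ ^ (n - s) * ∏ j ∈ Finset.range s, Nat.gcd (Nat.card Fˣ) (d j)) := by
  let E : Fin (r + r') → Fin n → ℕ := fun i j => if (i : ℕ) < r then E₁ i j else E₂ (i - r) j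
  have hE : stackM E₁ E₂ r r' n = Matrix.of fun i j => (E i j : ℤ) := by
    ext i j
    simp only [stackM, E, Matrix.of_apply]
    split_ifs <;> rfl
  rw [hE] at h
  have key := h.card_monomial_values hα hind fun w =>
    (∑ i : Fin (r + r'), if (i : ℕ) < r then (a₁ (i : ℕ) : F) * ((w i : F)) else 0) = b₁ ∧
    (∑ i : Fin (r + r'), if r ≤ (i : ℕ) then (a₂ ((i : ℕ) - r) : F) * ((w i : F)) else 0) = b₂
  simp only [and_assoc] at key
  rw [← key]
  let e : (Fin n → Fˣ) ≃ {x : Fin n → F // ∀ j, x j ≠ 0} :=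
    (Equiv.piCongrRight fun _ => unitsEquivNeZero).trans Equiv.subtypePiEquivPi.symm
  refine (Nat.card_congr ((Equiv.subtypeEquiv e fun x => ?_).trans
    (Equiv.subtypeSubtypeEquivSubtypeInter (fun x : Fin n → F => ∀ j, x j ≠ 0) fun x =>
      (∑ i ∈ Finset.range r, (a₁ i : F) * ∏ j : Fin n, x j ^ E₁ i (j : ℕ)) = b₁ ∧
      (∑ i ∈ Finset.range r', (a₂ i : F) * ∏ j : Fin n, x j ^ E₂ i (j : ℕ)) = b₂))).symm
  have hx : ∀ j, (e x : Fin n → F) j = (x j : F) := fun j => rfl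
  simp only [hx, Fin.sum_univ_add, Fin.val_castAdd, Fin.is_lt, if_true, Fin.val_natAdd,
    Nat.add_sub_cancel_left, Finset.sum_range, E]
  simp [fun i : Fin r => i.is_lt.not_ge]

/-- Two conditions on functions which depend on complementary sets of coordinates are
independent. -/
theorem card_subtype_and_mul_card_pi {ι K : Type*} [Finite ι] [Finite K] (p : ι → Prop)
    (A B : (ι → K) → Prop) (hA : ∀ x y : ι → K, (∀ i, p i → x i = y i) → (A x ↔ A y))
    (hB : ∀ x y : ι → K, (∀ i, ¬ p i → x i = y i) → (B x ↔ B y)) :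
    Nat.card {x // A x ∧ B x} * Nat.card (ι → K) = Nat.card {x // A x} * Nat.card {x // B x} := by
  classical
  let mix : (ι → K) → (ι → K) → ι → K := fun x y i => if p i then x i else y i
  have hmixp : ∀ x y i, p i → mix x y i = x i := fun x y i hi => if_pos hi
  have hmixn : ∀ x y i, ¬ p i → mix x y i = y i := fun x y i hi => if_neg hi
  have hmix : ∀ x y, mix (mix x y) (mix y x) = x := fun x y => by
    funext i
    by_cases hi : p i <;> simp [mix, hi]
  rw [← Nat.card_prod, ← Nat.card_prod]
  exact Nat.card_congr
    { toFun := fun z => (⟨mix z.1.1 z.2, (hA _ _ (hmixp _ _)).2 z.1.2.1⟩,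
        ⟨mix z.2 z.1.1, (hB _ _ (hmixn _ _)).2 z.1.2.2⟩)
      invFun := fun z => (⟨mix z.1.1 z.2.1, (hA _ _ (hmixp _ _)).2 z.1.2,
        (hB _ _ (hmixn _ _)).2 z.2.2⟩, mix z.2.1 z.1.1)
      left_inv := fun z => Prod.ext (Subtype.ext (hmix _ _)) (hmix _ _)
      right_inv := fun z => Prod.ext (Subtype.ext (hmix _ _)) (Subtype.ext (hmix _ _)) }

theorem card_ne_zero_on_Ico {F : Type*} [Field F] [Finite F] {n k l : ℕ} (hl : l ≤ n) :
    Nat.card {x : Fin n → F // ∀ j : Fin n, k ≤ (j : ℕ) → (j : ℕ) < l → x j ≠ 0} =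
      Nat.card Fˣ ^ (l - k) * Nat.card F ^ (n - (l - k)) := by
  have hcard : ∀ j : Fin n, Nat.card {t : F // k ≤ (j : ℕ) → (j : ℕ) < l → t ≠ 0} =
      if (j : ℕ) ∈ Finset.Ico k l then Nat.card Fˣ else Nat.card F := by
    intro j
    split_ifs with hj <;> rw [Finset.mem_Ico] at hj
    · rw [Nat.card_congr (unitsEquivNeZero (G₀ := F))]
      exact Nat.card_congr (Equiv.subtypeEquivRight fun t => by simp [hj])
    · exact Nat.card_congr (Equiv.subtypeUnivEquiv fun t h₁ h₂ => absurd ⟨h₁, h₂⟩ hj)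
  rw [Nat.card_congr (Equiv.subtypePiEquivPi
    (p := fun (j : Fin n) (t : F) => k ≤ (j : ℕ) → (j : ℕ) < l → t ≠ 0)), Nat.card_pi]
  simp only [hcard]
  have hsub : Finset.Ico k l ⊆ Finset.range n := fun j hj =>
    Finset.mem_range.2 ((Finset.mem_Ico.1 hj).2.trans_le hl)
  rw [Fin.prod_univ_eq_prod_range (fun j => if j ∈ Finset.Ico k l then Nat.card Fˣ
    else Nat.card F) n, Finset.prod_ite, Finset.prod_const, Finset.prod_const,
    Finset.filter_mem_eq_inter, Finset.inter_eq_right.2 hsub, Finset.filter_notMem_eq_sdiff,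
    Finset.card_sdiff_of_subset hsub, Nat.card_Ico, Finset.card_range]

theorem card_exists_eq_zero_on_Ico {F : Type*} [Field F] [Finite F] {n k l : ℕ} (hkl : k ≤ l)
    (hl : l ≤ n) :
    Nat.card {x : Fin n → F // ∃ j : Fin n, k ≤ (j : ℕ) ∧ (j : ℕ) < l ∧ x j = 0} =
      Nat.card F ^ (n - (l - k)) * (Nat.card F ^ (l - k) - Nat.card Fˣ ^ (l - k)) := by
  classical
  have := Fintype.ofFinite F
  have h := Finset.card_filter_add_card_filter_not (s := (Finset.univ : Finset (Fin n → F)))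
    (fun x => ∀ j : Fin n, k ≤ (j : ℕ) → (j : ℕ) < l → x j ≠ 0)
  rw [← Fintype.card_subtype, ← Fintype.card_subtype, ← Nat.card_eq_fintype_card,
    ← Nat.card_eq_fintype_card, card_ne_zero_on_Ico hl, Finset.card_univ,
    ← Nat.card_eq_fintype_card, Nat.card_fun, Nat.card_fin] at h
  push Not at h
  rw [Nat.mul_sub, ← pow_add, show n - (l - k) + (l - k) = n by omega, ← h,
    mul_comm (Nat.card F ^ _), Nat.add_sub_cancel_left]

/-- The point `x` solves the two equations given by the first `r` rows of `E₁` and the first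
`r'` rows of `E₂`. -/
def SolvesPair {F : Type*} [Field F] (a₁ a₂ : ℕ → Fˣ) (b₁ b₂ : F) (E₁ E₂ : ℕ → ℕ → ℕ)
    (r r' : ℕ) {n : ℕ} (x : Fin n → F) : Prop :=
  (∑ i ∈ Finset.range r, (a₁ i : F) * ∏ j : Fin n, x j ^ E₁ i (j : ℕ)) = b₁ ∧
  (∑ i ∈ Finset.range r', (a₂ i : F) * ∏ j : Fin n, x j ^ E₂ i (j : ℕ)) = b₂

theorem sum_monomials_congr {F : Type*} [Field F] (a : ℕ → Fˣ) {E : ℕ → ℕ → ℕ} {r k n : ℕ}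
    (hE : ∀ i, i < r → ∀ j, k ≤ j → E i j = 0) {x y : Fin n → F}
    (hxy : ∀ j : Fin n, (j : ℕ) < k → x j = y j) :
    (∑ i ∈ Finset.range r, (a i : F) * ∏ j : Fin n, x j ^ E i (j : ℕ)) =
      ∑ i ∈ Finset.range r, (a i : F) * ∏ j : Fin n, y j ^ E i (j : ℕ) := by
  refine Finset.sum_congr rfl fun i hi => ?_
  congr 1
  refine Finset.prod_congr rfl fun j _ => ?_
  rcases lt_or_ge (j : ℕ) k with hj | hj
  · rw [hxy j hj]
  · rw [hE i (Finset.mem_range.1 hi) j hj, pow_zero, pow_zero]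

theorem sum_monomials_eq_of_vanish {F : Type*} [Field F] (a : ℕ → Fˣ) {E : ℕ → ℕ → ℕ}
    {r₀ r n : ℕ} (hr : r₀ ≤ r) {x : Fin n → F} {j : Fin n} (hxj : x j = 0)
    (hE : ∀ i, r₀ ≤ i → i < r → 0 < E i j) :
    (∑ i ∈ Finset.range r, (a i : F) * ∏ j : Fin n, x j ^ E i (j : ℕ)) =
      ∑ i ∈ Finset.range r₀, (a i : F) * ∏ j : Fin n, x j ^ E i (j : ℕ) := by
  rw [← Finset.sum_range_add_sum_Ico _ hr, add_eq_left]
  refine Finset.sum_eq_zero fun i hi => ?_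
  obtain ⟨h₁, h₂⟩ := Finset.mem_Ico.1 hi
  rw [Finset.prod_eq_zero (Finset.mem_univ j) (by rw [hxj, zero_pow (hE i h₁ h₂).ne']), mul_zero]

theorem stackM_eq_zero {E₁ E₂ : ℕ → ℕ → ℕ} {r r' k n : ℕ}
    (h₁ : ∀ i, i < r → ∀ j, k ≤ j → E₁ i j = 0)
    (h₂ : ∀ i, i < r' → ∀ j, k ≤ j → E₂ i j = 0) (i : Fin (r + r')) (j : Fin n)
    (hj : k ≤ (j : ℕ)) : stackM E₁ E₂ r r' n i j = 0 := by
  simp only [stackM, Matrix.of_apply]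
  split_ifs with hi
  · rw [h₁ _ hi _ hj, Nat.cast_zero]
  · rw [h₂ _ (by omega) _ hj, Nat.cast_zero]

/-- The solutions of a pair of equations in the first `k` coordinates for which these
coordinates are nonzero. -/
theorem IsSmithDatum.card_solvesPair_ne_zero {F : Type*} [Field F] [Finite F] {α : Fˣ}
    (hα : ∀ β : Fˣ, β ∈ Subgroup.zpowers α) {ind : Fˣ → ℕ} (hind : ∀ β, α ^ ind β = β)
    {r r' k n : ℕ} (hk : k ≤ n) {E₁ E₂ : ℕ → ℕ → ℕ}
    (h₁ : ∀ i, i < r → ∀ j, k ≤ j → E₁ i j = 0)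
    (h₂ : ∀ i, i < r' → ∀ j, k ≤ j → E₂ i j = 0)
    {U : Matrix (Fin (r + r')) (Fin (r + r')) ℤ} {V : Matrix (Fin n) (Fin n) ℤ}
    {s : ℕ} {d : ℕ → ℕ} (h : IsSmithDatum (stackM E₁ E₂ r r' n) U V s d)
    (a₁ a₂ : ℕ → Fˣ) (b₁ b₂ : F) :
    Nat.card {x : Fin n → F // (∀ j : Fin n, (j : ℕ) < k → x j ≠ 0) ∧
        SolvesPair a₁ a₂ b₁ b₂ E₁ E₂ r r' x} =
      Nat.card F ^ (n - k) * (Nat.card {w : Fin (r + r') → Fˣ //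
        (∑ i : Fin (r + r'), if (i : ℕ) < r then (a₁ (i : ℕ) : F) * ((w i : F)) else 0) = b₁ ∧
        (∑ i : Fin (r + r'),
          if r ≤ (i : ℕ) then (a₂ ((i : ℕ) - r) : F) * ((w i : F)) else 0) = b₂ ∧
        IndexCond (Nat.card Fˣ) U s d fun i => (ind (w i) : ℤ)} *
      Nat.card Fˣ ^ (k - s) * ∏ j ∈ Finset.range s, Nat.gcd (Nat.card Fˣ) (d j)) := by
  have hsk : s ≤ k := h.le_of_cols_eq_zero hk (stackM_eq_zero h₁ h₂)
  have htorus := h.card_torus_points hα hind a₁ a₂ b₁ b₂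
  have hprod := card_subtype_and_mul_card_pi (fun j : Fin n => (j : ℕ) < k)
    (fun x : Fin n → F => (∀ j : Fin n, (j : ℕ) < k → x j ≠ 0) ∧
      SolvesPair a₁ a₂ b₁ b₂ E₁ E₂ r r' x)
    (fun x => ∀ j : Fin n, k ≤ (j : ℕ) → (j : ℕ) < n → x j ≠ 0)
    (fun x y hxy => by
      refine and_congr (forall₂_congr fun j hj => by rw [hxy j hj]) ?_
      rw [SolvesPair, SolvesPair, sum_monomials_congr a₁ h₁ hxy, sum_monomials_congr a₂ h₂ hxy])
    (fun x y hxy => forall₂_congr fun j hj => by rw [hxy j hj.not_gt])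
  rw [card_ne_zero_on_Ico le_rfl, Nat.card_fun, Nat.card_fin,
    show n - (n - k) = k by omega] at hprod
  have hcongr : Nat.card {x : Fin n → F // ((∀ j : Fin n, (j : ℕ) < k → x j ≠ 0) ∧
      SolvesPair a₁ a₂ b₁ b₂ E₁ E₂ r r' x) ∧
      ∀ j : Fin n, k ≤ (j : ℕ) → (j : ℕ) < n → x j ≠ 0} =
      Nat.card {x : Fin n → F // (∀ j, x j ≠ 0) ∧ SolvesPair a₁ a₂ b₁ b₂ E₁ E₂ r r' x} := by
    refine Nat.card_congr (Equiv.subtypeEquivRight fun x => ⟨fun hx => ⟨fun j => ?_, hx.1.2⟩,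
      fun hx => ⟨⟨fun j _ => hx.1 j, hx.2⟩, fun j _ _ => hx.1 j⟩⟩)
    rcases lt_or_ge (j : ℕ) k with hj | hj
    · exact hx.1.1 j hj
    · exact hx.2 j hj j.2
  simp only [SolvesPair] at hcongr hprod ⊢
  rw [hcongr, htorus, show n - s = (n - k) + (k - s) by omega, pow_add] at hprod
  have hpos : 0 < Nat.card Fˣ ^ (n - k) * Nat.card F ^ k :=
    Nat.mul_pos (pow_pos Nat.card_pos _) (pow_pos Nat.card_pos _)
  refine Nat.eq_of_mul_eq_mul_right hpos (hprod.symm.trans ?_)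
  rw [show Nat.card F ^ n = Nat.card F ^ (n - k) * Nat.card F ^ k by
    rw [← pow_add]; congr 1; omega]
  ring

/-- The solutions of a pair of equations in the first `k` coordinates for which these
coordinates are nonzero, while one of the coordinates between `k` and `l` vanishes. -/
theorem IsSmithDatum.card_solvesPair_stratum {F : Type*} [Field F] [Finite F] {α : Fˣ}
    (hα : ∀ β : Fˣ, β ∈ Subgroup.zpowers α) {ind : Fˣ → ℕ} (hind : ∀ β, α ^ ind β = β)
    {r r' k l n : ℕ} (hkl : k ≤ l) (hl : l ≤ n) {E₁ E₂ : ℕ → ℕ → ℕ}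
    (h₁ : ∀ i, i < r → ∀ j, k ≤ j → E₁ i j = 0)
    (h₂ : ∀ i, i < r' → ∀ j, k ≤ j → E₂ i j = 0)
    {U : Matrix (Fin (r + r')) (Fin (r + r')) ℤ} {V : Matrix (Fin n) (Fin n) ℤ}
    {s : ℕ} {d : ℕ → ℕ} (h : IsSmithDatum (stackM E₁ E₂ r r' n) U V s d)
    (a₁ a₂ : ℕ → Fˣ) (b₁ b₂ : F) :
    Nat.card {x : Fin n → F // ((∀ j : Fin n, (j : ℕ) < k → x j ≠ 0) ∧
        SolvesPair a₁ a₂ b₁ b₂ E₁ E₂ r r' x) ∧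
        ∃ j : Fin n, k ≤ (j : ℕ) ∧ (j : ℕ) < l ∧ x j = 0} =
      Nat.card F ^ (n - l) * (Nat.card F ^ (l - k) - Nat.card Fˣ ^ (l - k)) *
      (Nat.card {w : Fin (r + r') → Fˣ //
        (∑ i : Fin (r + r'), if (i : ℕ) < r then (a₁ (i : ℕ) : F) * ((w i : F)) else 0) = b₁ ∧
        (∑ i : Fin (r + r'),
          if r ≤ (i : ℕ) then (a₂ ((i : ℕ) - r) : F) * ((w i : F)) else 0) = b₂ ∧
        IndexCond (Nat.card Fˣ) U s d fun i => (ind (w i) : ℤ)} *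
      Nat.card Fˣ ^ (k - s) * ∏ j ∈ Finset.range s, Nat.gcd (Nat.card Fˣ) (d j)) := by
  have hprod := card_subtype_and_mul_card_pi (fun j : Fin n => (j : ℕ) < k)
    (fun x : Fin n → F => (∀ j : Fin n, (j : ℕ) < k → x j ≠ 0) ∧
      SolvesPair a₁ a₂ b₁ b₂ E₁ E₂ r r' x)
    (fun x => ∃ j : Fin n, k ≤ (j : ℕ) ∧ (j : ℕ) < l ∧ x j = 0)
    (fun x y hxy => by
      refine and_congr (forall₂_congr fun j hj => by rw [hxy j hj]) ?_
      rw [SolvesPair, SolvesPair, sum_monomials_congr a₁ h₁ hxy, sum_monomials_congr a₂ h₂ hxy])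
    (fun x y hxy => exists_congr fun j => and_congr_right fun hj => by rw [hxy j hj.not_gt])
  rw [card_exists_eq_zero_on_Ico hkl hl, Nat.card_fun, Nat.card_fin,
    h.card_solvesPair_ne_zero hα hind (hkl.trans hl) h₁ h₂ a₁ a₂ b₁ b₂] at hprod
  refine Nat.eq_of_mul_eq_mul_right (pow_pos Nat.card_pos n) (hprod.trans ?_)
  have hpow : Nat.card F ^ (n - k) * Nat.card F ^ (n - (l - k)) =
      Nat.card F ^ (n - l) * Nat.card F ^ n := by
    rw [← pow_add, ← pow_add]
    congr 1
    omega
  linear_combination (Nat.card F ^ (l - k) - Nat.card Fˣ ^ (l - k)) *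
      (Nat.card {w : Fin (r + r') → Fˣ //
        (∑ i : Fin (r + r'), if (i : ℕ) < r then (a₁ (i : ℕ) : F) * ((w i : F)) else 0) = b₁ ∧
        (∑ i : Fin (r + r'),
          if r ≤ (i : ℕ) then (a₂ ((i : ℕ) - r) : F) * ((w i : F)) else 0) = b₂ ∧
        IndexCond (Nat.card Fˣ) U s d fun i => (ind (w i) : ℤ)} *
      Nat.card Fˣ ^ (k - s) * ∏ j ∈ Finset.range s, Nat.gcd (Nat.card Fˣ) (d j)) * hpow

theorem card_subtype_eq_add_card_subtype_and {X : Type*} [Finite X] (S A : X → Prop) :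
    Nat.card {x // S x} = Nat.card {x // S x ∧ ¬ A x} + Nat.card {x // A x ∧ S x} := by
  classical
  have := Fintype.ofFinite X
  simp only [Nat.card_eq_fintype_card, Fintype.card_subtype]
  rw [add_comm, ← Finset.card_filter_add_card_filter_not (s := Finset.univ.filter S) A,
    Finset.filter_filter, Finset.filter_filter]
  simp only [and_comm]

theorem rational_points_case_n1_eq_n3_n2_lt_n4
    (F : Type) [Field F] [Fintype F] [DecidableEq F]
    (q : ℕ) (hq : q = Fintype.card F)
    (hqpow : ∃ p k : ℕ, Nat.Prime p ∧ Odd p ∧ 0 < k ∧ q = p ^ k)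
    (α : Fˣ) (hα : ∀ β : Fˣ, β ∈ Subgroup.zpowers α)
    (ind : Fˣ → ℕ)
    (hind : ∀ β : Fˣ, 1 ≤ ind β ∧ ind β ≤ q - 1 ∧ α ^ ind β = β)
    (r₁ r₂ r₃ r₄ n₁ n₂ n₃ n₄ : ℕ)
    (hr₁ : 0 < r₁) (hr₁₂ : r₁ < r₂) (hr₃ : 0 < r₃) (hr₃₄ : r₃ < r₄)
    (hn₁ : 0 < n₁) (hn₁₂ : n₁ < n₂) (hn₃ : 0 < n₃) (hn₃₄ : n₃ < n₄)
    (hn₁₃ : n₁ ≤ n₃)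
    (b₁ b₂ : F) (a₁ a₂ : ℕ → Fˣ)
    (E₁ E₂ : ℕ → ℕ → ℕ)
    (hE₁p : ∀ i, i < r₁ → ∀ j, j < n₁ → 0 < E₁ i j)
    (hE₁z : ∀ i, i < r₁ → ∀ j, n₁ ≤ j → E₁ i j = 0)
    (hE₁p' : ∀ i, r₁ ≤ i → i < r₂ → ∀ j, j < n₂ → 0 < E₁ i j)
    (hE₁z' : ∀ i, r₁ ≤ i → i < r₂ → ∀ j, n₂ ≤ j → E₁ i j = 0)
    (hE₂p : ∀ i, i < r₃ → ∀ j, j < n₃ → 0 < E₂ i j)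
    (hE₂z : ∀ i, i < r₃ → ∀ j, n₃ ≤ j → E₂ i j = 0)
    (hE₂p' : ∀ i, r₃ ≤ i → i < r₄ → ∀ j, j < n₄ → 0 < E₂ i j)
    (hE₂z' : ∀ i, r₃ ≤ i → i < r₄ → ∀ j, n₄ ≤ j → E₂ i j = 0)
    (h₁₃ : n₁ = n₃) (h₂₄ : n₂ < n₄)
    (U₃ : Matrix (Fin (r₁ + r₃)) (Fin (r₁ + r₃)) ℤ) (V₃ : Matrix (Fin (n₄)) (Fin (n₄)) ℤ)
    (s₃ : ℕ) (d₃ : ℕ → ℕ)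
    (hSD₃ : IsSmithDatum (stackM E₁ E₂ r₁ r₃ n₄) U₃ V₃ s₃ d₃)
    (U₂ : Matrix (Fin (r₂ + r₃)) (Fin (r₂ + r₃)) ℤ) (V₂ : Matrix (Fin (n₄)) (Fin (n₄)) ℤ)
    (s₂ : ℕ) (d₂ : ℕ → ℕ)
    (hSD₂ : IsSmithDatum (stackM E₁ E₂ r₂ r₃ n₄) U₂ V₂ s₂ d₂)
    (U₄ : Matrix (Fin (r₂ + r₄)) (Fin (r₂ + r₄)) ℤ) (V₄ : Matrix (Fin (n₄)) (Fin (n₄)) ℤ)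
    (s₄ : ℕ) (d₄ : ℕ → ℕ)
    (hSD₄ : IsSmithDatum (stackM E₁ E₂ r₂ r₄ n₄) U₄ V₄ s₄ d₄)
    (H₃ : ℕ)
    (hH₃ : H₃ = Nat.card {w : Fin (r₁ + r₃) → Fˣ //
      (∑ i : Fin (r₁ + r₃), if (i : ℕ) < r₁ then (a₁ (i : ℕ) : F) * ((w i : F)) else 0) = b₁ ∧
      (∑ i : Fin (r₁ + r₃), if r₁ ≤ (i : ℕ) then (a₂ ((i : ℕ) - r₁) : F) * ((w i : F)) else 0) = b₂ ∧
      IndexCond (q - 1) U₃ s₃ d₃ fun i => (ind (w i) : ℤ)})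
    (H₂ : ℕ)
    (hH₂ : H₂ = Nat.card {w : Fin (r₂ + r₃) → Fˣ //
      (∑ i : Fin (r₂ + r₃), if (i : ℕ) < r₂ then (a₁ (i : ℕ) : F) * ((w i : F)) else 0) = b₁ ∧
      (∑ i : Fin (r₂ + r₃), if r₂ ≤ (i : ℕ) then (a₂ ((i : ℕ) - r₂) : F) * ((w i : F)) else 0) = b₂ ∧
      IndexCond (q - 1) U₂ s₂ d₂ fun i => (ind (w i) : ℤ)})
    (H₄ : ℕ)
    (hH₄ : H₄ = Nat.card {w : Fin (r₂ + r₄) → Fˣ //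
      (∑ i : Fin (r₂ + r₄), if (i : ℕ) < r₂ then (a₁ (i : ℕ) : F) * ((w i : F)) else 0) = b₁ ∧
      (∑ i : Fin (r₂ + r₄), if r₂ ≤ (i : ℕ) then (a₂ ((i : ℕ) - r₂) : F) * ((w i : F)) else 0) = b₂ ∧
      IndexCond (q - 1) U₄ s₄ d₄ fun i => (ind (w i) : ℤ)})
    (L₂ : ℕ)
    (hL₂ : L₂ = H₂ * (q - 1) ^ (n₂ - s₂) * ∏ j ∈ Finset.range s₂, Nat.gcd (q - 1) (d₂ j))
    (L₃ : ℕ)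
    (hL₃ : L₃ = H₃ * (q - 1) ^ (n₃ - s₃) * ∏ j ∈ Finset.range s₃, Nat.gcd (q - 1) (d₃ j))
    (L₄ : ℕ)
    (hL₄ : L₄ = H₄ * (q - 1) ^ (n₄ - s₄) * ∏ j ∈ Finset.range s₄, Nat.gcd (q - 1) (d₄ j))
    :
    Nat.card {x : Fin (n₄) → F //
      (∑ i ∈ Finset.range r₂, (a₁ i : F) * ∏ j : Fin (n₄), x j ^ E₁ i (j : ℕ)) = b₁ ∧
      (∑ i ∈ Finset.range r₄, (a₂ i : F) * ∏ j : Fin (n₄), x j ^ E₂ i (j : ℕ)) = b₂} =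
      (if b₁ = 0 ∧ b₂ = 0 then q ^ (n₄ - n₁) * (q ^ n₁ - (q - 1) ^ n₁) else 0) +
      q ^ (n₄ - n₂) * (q ^ (n₂ - n₃) - (q - 1) ^ (n₂ - n₃)) * L₃ +
      (q ^ (n₄ - n₂) - (q - 1) ^ (n₄ - n₂)) * L₂ +
      L₄ := by
  have hm : Nat.card Fˣ = q - 1 := by
    rw [Nat.card_eq_fintype_card, Fintype.card_units, hq]
  have hF : Nat.card F = q := by rw [Nat.card_eq_fintype_card, hq]
  have hlog : ∀ β, α ^ ind β = β := fun β => (hind β).2.2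
  subst h₁₃
  have hE₁z₂ : ∀ i, i < r₂ → ∀ j, n₂ ≤ j → E₁ i j = 0 := fun i hi j hj =>
    (lt_or_ge i r₁).elim (fun h => hE₁z i h j (hn₁₂.le.trans hj)) fun h => hE₁z' i h hi j hj
  have hE₂z₃ : ∀ i, i < r₃ → ∀ j, n₂ ≤ j → E₂ i j = 0 := fun i hi j hj =>
    hE₂z i hi j (hn₁₂.le.trans hj)
  have hE₁z₄ : ∀ i, i < r₂ → ∀ j, n₄ ≤ j → E₁ i j = 0 := fun i hi j hj =>
    hE₁z₂ i hi j (h₂₄.le.trans hj)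
  have hE₂z₄ : ∀ i, i < r₄ → ∀ j, n₄ ≤ j → E₂ i j = 0 := fun i hi j hj =>
    (lt_or_ge i r₃).elim (fun h => hE₂z i h j (hn₃₄.le.trans hj)) fun h => hE₂z' i h hi j hj
  have hS₃ := hSD₃.card_solvesPair_stratum hα hlog hn₁₂.le h₂₄.le hE₁z hE₂z a₁ a₂ b₁ b₂
  have hS₂ := hSD₂.card_solvesPair_stratum hα hlog h₂₄.le le_rfl hE₁z₂ hE₂z₃ a₁ a₂ b₁ b₂
  have hS₄ := hSD₄.card_solvesPair_ne_zero hα hlog le_rfl hE₁z₄ hE₂z₄ a₁ a₂ b₁ b₂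
  rw [hm, hF, ← hH₃, ← hL₃] at hS₃
  rw [hm, hF, ← hH₂, ← hL₂, Nat.sub_self, pow_zero, one_mul] at hS₂
  rw [hm, hF, ← hH₄, ← hL₄, Nat.sub_self, pow_zero, one_mul] at hS₄
  have hS₀ := card_exists_eq_zero_on_Ico (F := F) (n := n₄) (Nat.zero_le n₁) hn₃₄.le
  rw [hm, hF, Nat.sub_zero] at hS₀
  let S : (Fin n₄ → F) → Prop := SolvesPair a₁ a₂ b₁ b₂ E₁ E₂ r₂ r₄
  let Z : ℕ → (Fin n₄ → F) → Prop := fun k x => ∀ j : Fin n₄, (j : ℕ) < k → x j ≠ 0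
  have hsum : ∀ (x : Fin n₄ → F) (j : Fin n₄), x j = 0 → (j : ℕ) < n₁ →
      (S x ↔ b₁ = 0 ∧ b₂ = 0) := by
    intro x j hj hjn
    simp only [S, SolvesPair]
    rw [sum_monomials_eq_of_vanish a₁ (Nat.zero_le r₂) hj fun i _ hi =>
        (lt_or_ge i r₁).elim (fun h => hE₁p i h j hjn) fun h => hE₁p' i h hi j (hjn.trans hn₁₂),
      sum_monomials_eq_of_vanish a₂ (Nat.zero_le r₄) hj fun i _ hi =>
        (lt_or_ge i r₃).elim (fun h => hE₂p i h j hjn) fun h => hE₂p' i h hi j j.2]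
    simp [eq_comm]
  have hC₀ : Nat.card {x // S x ∧ ¬ Z n₁ x} =
      if b₁ = 0 ∧ b₂ = 0 then q ^ (n₄ - n₁) * (q ^ n₁ - (q - 1) ^ n₁) else 0 := by
    split_ifs with hb
    · rw [← hS₀]
      refine Nat.card_congr (Equiv.subtypeEquivRight fun x => ?_)
      simp only [Z, not_forall, not_not, Nat.zero_le, true_and, exists_prop]
      exact ⟨fun hx => hx.2, fun hx => ⟨(hsum x _ hx.choose_spec.2 hx.choose_spec.1).2 hb, hx⟩⟩
    · rw [Nat.card_eq_zero]
      refine Or.inl ⟨fun ⟨x, hx, hz⟩ => hb ?_⟩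
      simp only [Z, not_forall, not_not, exists_prop] at hz
      obtain ⟨j, hj, hxj⟩ := hz
      exact (hsum x j hxj hj).1 hx
  have hC₃ : Nat.card {x // (Z n₁ x ∧ S x) ∧ ¬ Z n₂ x} =
      q ^ (n₄ - n₂) * (q ^ (n₂ - n₁) - (q - 1) ^ (n₂ - n₁)) * L₃ := by
    rw [← hS₃]
    refine Nat.card_congr (Equiv.subtypeEquivRight fun x => ?_)
    have hiff : ∀ j : Fin n₄, x j = 0 → (j : ℕ) < n₂ →
        (S x ↔ SolvesPair a₁ a₂ b₁ b₂ E₁ E₂ r₁ r₃ x) := by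
      intro j hj hjn
      simp only [S, SolvesPair]
      rw [sum_monomials_eq_of_vanish a₁ hr₁₂.le hj fun i h hi => hE₁p' i h hi j hjn,
        sum_monomials_eq_of_vanish a₂ hr₃₄.le hj fun i h hi => hE₂p' i h hi j j.2]
    simp only [Z, not_forall, not_not, exists_prop]
    constructor
    · rintro ⟨⟨hz, hx⟩, j, hj, hxj⟩
      exact ⟨⟨hz, (hiff j hxj hj).1 hx⟩, j, not_lt.1 fun h => hz j h hxj, hj, hxj⟩
    · rintro ⟨⟨hz, hx⟩, j, -, hj, hxj⟩
      exact ⟨⟨hz, (hiff j hxj hj).2 hx⟩, j, hj, hxj⟩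
  have hC₂ : Nat.card {x // (Z n₂ x ∧ S x) ∧ ¬ Z n₄ x} =
      (q ^ (n₄ - n₂) - (q - 1) ^ (n₄ - n₂)) * L₂ := by
    rw [← hS₂]
    refine Nat.card_congr (Equiv.subtypeEquivRight fun x => ?_)
    have hiff : ∀ j : Fin n₄, x j = 0 →
        (S x ↔ SolvesPair a₁ a₂ b₁ b₂ E₁ E₂ r₂ r₃ x) := by
      intro j hj
      simp only [S, SolvesPair]
      rw [sum_monomials_eq_of_vanish a₂ hr₃₄.le hj fun i h hi => hE₂p' i h hi j j.2]
    simp only [Z, not_forall, not_not, exists_prop]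
    constructor
    · rintro ⟨⟨hz, hx⟩, j, hj, hxj⟩
      exact ⟨⟨hz, (hiff j hxj).1 hx⟩, j, not_lt.1 fun h => hz j h hxj, hj, hxj⟩
    · rintro ⟨⟨hz, hx⟩, j, -, hj, hxj⟩
      exact ⟨⟨hz, (hiff j hxj).2 hx⟩, j, hj, hxj⟩
  have hmono : ∀ k l, k ≤ l → Nat.card {x // Z l x ∧ Z k x ∧ S x} =
      Nat.card {x // Z l x ∧ S x} := fun k l hkl =>
    Nat.card_congr (Equiv.subtypeEquivRight fun x =>
      ⟨fun hx => ⟨hx.1, hx.2.2⟩, fun hx => ⟨hx.1, fun j hj => hx.1 j (hj.trans_le hkl), hx.2⟩⟩)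
  change Nat.card {x // S x} = _
  rw [card_subtype_eq_add_card_subtype_and S (Z n₁), hC₀,
    card_subtype_eq_add_card_subtype_and (fun x => Z n₁ x ∧ S x) (Z n₂), hC₃, hmono _ _ hn₁₂.le,
    card_subtype_eq_add_card_subtype_and (fun x => Z n₂ x ∧ S x) (Z n₄), hC₂, hmono _ _ h₂₄.le,
    ← hS₄]
  ring
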